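/- Let L be a finite-dimensional p-nilpotent restricted Lie algebra over a perfect field F of characteristic p > 0, with X and E as in the context. Then E/J_L is a central restricted Lie ideal of the restricted Lie algebra ω(L)/J_L: [E, ω(L)] ⊆ J_L and u^p ∈ E for every u ∈ E. -/

import Mathlib

open UniversalEnvelopingAlgebra

attribute [local instance 100] LieRing.ofAssociativeRing

/-- A restricted Lie algebra over a field `F` of characteristic `p`: a Lie algebra equipped
with a `p`-map `x ↦ x^[p]` satisfying Jacobson's identities.  The additive identity
`(x+y)^[p] = x^[p] + y^[p] + Σ sᵢ(x,y)` (with `sᵢ` the Jacobson polynomials) is expressed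
faithfully inside the universal enveloping algebra, where it reads
`ι((x+y)^[p]) - ι(x^[p]) - ι(y^[p]) = (ι x + ι y)^p - (ι x)^p - (ι y)^p`. -/
class RestrictedLieAlgebra (p : ℕ) (F : Type*) (L : Type*) [Field F]
    [LieRing L] [LieAlgebra F L] : Type _ where
  pOp : L → L
  pOp_smul : ∀ (a : F) (x : L), pOp (a • x) = a ^ p • pOp x
  ad_pOp : ∀ x y : L, ⁅pOp x, y⁆ = ((LieAlgebra.ad F L x) ^ p) y
  pOp_add : ∀ x y : L,
    ι F (pOp (x + y)) - ι F (pOp x) - ι F (pOp y)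
      = (ι F x + ι F y) ^ p - (ι F x) ^ p - (ι F y) ^ p

namespace RestrictedLieAlgebra

variable (p : ℕ) (F : Type*) [Field F]

section Defs

variable (L : Type*) [LieRing L] [LieAlgebra F L] [RestrictedLieAlgebra p F L]

/-- The `p`-map of a restricted Lie algebra. -/
abbrev pmap (x : L) : L := RestrictedLieAlgebra.pOp (p := p) (F := F) x

/-- The relation defining the restricted enveloping algebra as a quotient of the
universal enveloping algebra: `x^p = x^[p]` for all `x ∈ L`. -/
def uRel : UniversalEnvelopingAlgebra F L → UniversalEnvelopingAlgebra F L → Prop :=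
  fun a b => ∃ x : L, a = (ι F x) ^ p ∧ b = ι F (pmap p F L x)

/-- The restricted enveloping algebra `u(L)`: the quotient of the universal enveloping
algebra of `L` by the two-sided ideal generated by `{x^p - x^[p] : x ∈ L}`. -/
abbrev uEnv := RingQuot (uRel p F L)

/-- The canonical (linear) embedding `L → u(L)`. -/
def uemb : L →ₗ[F] uEnv p F L :=
  ((RingQuot.mkAlgHom F (uRel p F L)).toLinearMap).comp (ι F : L →ₗ⁅F⁆ _).toLinearMap

variable [Fact p.Prime]

/-- The augmentation map `ε : u(L) → F`, induced by `x ↦ 0` for `x ∈ L`. -/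
noncomputable def aug : uEnv p F L →ₐ[F] F :=
  RingQuot.liftAlgHom F
    ⟨(UniversalEnvelopingAlgebra.lift F) (0 : L →ₗ⁅F⁆ F), by
      rintro a b ⟨x, rfl, rfl⟩
      simp [UniversalEnvelopingAlgebra.lift_ι_apply,
        zero_pow (Nat.Prime.ne_zero (Fact.out : p.Prime))]⟩

/-- The augmentation ideal `ω(L)`, i.e. the kernel of the augmentation map, as a
subspace of `u(L)`. -/
noncomputable def omegaIdeal : Submodule F (uEnv p F L) :=
  LinearMap.ker (aug p F L).toLinearMap

/-- The image of `L` inside `u(L)`. -/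
def lSub : Submodule F (uEnv p F L) := LinearMap.range (uemb p F L)

end Defs

section Closure

variable {L : Type*} [LieRing L] [LieAlgebra F L] [RestrictedLieAlgebra p F L]

/-- The restricted subalgebra generated by a subset `S` of `L`: the smallest Lie
subalgebra containing `S` which is closed under the `p`-map. -/
def restrictedClosure (S : Set L) : LieSubalgebra F L :=
  sInf {K : LieSubalgebra F L | S ⊆ K ∧ ∀ x ∈ K, pmap p F L x ∈ K}

/-- For a subalgebra `N ⊆ L`, the restricted subalgebra `N^p` generated by all
`x^[p]`, `x ∈ N`. -/
def subPPow (K : LieSubalgebra F L) : LieSubalgebra F L :=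
  restrictedClosure p F (pmap p F L '' K)

end Closure

section PNilpotent

variable (L : Type*) [LieRing L] [LieAlgebra F L] [RestrictedLieAlgebra p F L]

/-- `L` is `p`-nilpotent if `L^{pˢ} = 0` for some `s`, where `L^p` denotes the restricted
subalgebra generated by all `x^[p]`. -/
def IsPNilpotent : Prop :=
  ∃ s : ℕ, (subPPow p F)^[s] (⊤ : LieSubalgebra F L) = ⊥

/-- The derived subalgebra `L' = γ₂(L)` as a submodule of `L`. -/
abbrev derivedSub : Submodule F L := (LieModule.lowerCentralSeries F L L 1).toSubmodule

/-- `L'_p`, the restricted subalgebra generated by `L'`, as a submodule. -/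
def derivedP : Submodule F L :=
  (restrictedClosure p F (derivedSub F L : Set L)).toSubmodule

/-- `L'^p + γ₃(L)`, as a submodule of `L`. -/
def mainIdeal : Submodule F L :=
  (subPPow p F (restrictedClosure p F (derivedSub F L : Set L))).toSubmodule
    ⊔ (LieModule.lowerCentralSeries F L L 2).toSubmodule

end PNilpotent

end RestrictedLieAlgebra

namespace RestrictedLieAlgebra

section Setup

variable (p : ℕ) (F : Type*) [Field F] [Fact p.Prime]
variable (L : Type*) [LieRing L] [LieAlgebra F L] [RestrictedLieAlgebra p F L]

/-- The ideal `J_L = ω(L)L' + L'ω(L)` of `u(L)`, as a subspace. -/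
noncomputable def jIdeal : Submodule F (uEnv p F L) :=
  omegaIdeal p F L * ((derivedSub F L).map (uemb p F L))
    + ((derivedSub F L).map (uemb p F L)) * omegaIdeal p F L

/-- The subspace `E` of `u(L)`: the span of `J_L` together with all PBW monomials of
degree at least two in the fixed set `X` of representatives. -/
noncomputable def eSpace (n : ℕ) (ex : Fin n → ℕ) (X : (i : Fin n) → Fin (ex i) → L) :
    Submodule F (uEnv p F L) :=
  jIdeal p F L ⊔
    Submodule.span F
      {u : uEnv p F L | ∃ a : (i : Fin n) → Fin (ex i) → ℕ,
        (∀ i j, a i j < p) ∧ 2 ≤ ∑ i, ∑ j, a i j ∧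
        u = ((List.finRange n).map (fun i =>
              ((List.finRange (ex i)).map
                (fun j => uemb p F L (X i j) ^ a i j)).prod)).prod}

/-- The data `e₁, …, e_n ∈ L` together with exponents `ex i = exp(ēᵢ)` and a set `X` of
coset representatives, expressing the decomposition
`L/L'_p = ⟨ē₁⟩_p ⊕ ⋯ ⊕ ⟨ē_n⟩_p` via the resulting basis `ēᵢ^{[p]^j}` (`0 ≤ j < ex i`)
of `L/L'_p`. -/
def GoodPresentation (n : ℕ) (e : Fin n → L) (ex : Fin n → ℕ)
    (X : (i : Fin n) → Fin (ex i) → L) : Prop :=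
  LinearIndependent F
    (fun q : Σ i : Fin n, Fin (ex i) =>
      (Submodule.Quotient.mk ((pmap p F L)^[(q.2 : ℕ)] (e q.1)) : L ⧸ derivedP p F L)) ∧
  Submodule.span F
    (Set.range (fun q : Σ i : Fin n, Fin (ex i) =>
      (Submodule.Quotient.mk ((pmap p F L)^[(q.2 : ℕ)] (e q.1)) : L ⧸ derivedP p F L))) = ⊤ ∧
  (∀ i, (pmap p F L)^[ex i] (e i) ∈ derivedP p F L) ∧
  (∀ i (j : Fin (ex i)), X i j - (pmap p F L)^[(j : ℕ)] (e i) ∈ derivedP p F L)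

end Setup

end RestrictedLieAlgebra

namespace RestrictedLieAlgebra

section Ideals

variable {p : ℕ} {F : Type*} [Field F]
variable {L : Type*} [LieRing L] [LieAlgebra F L] [RestrictedLieAlgebra p F L]

theorem uemb_pmap (x : L) : uemb p F L (pmap p F L x) = uemb p F L x ^ p := by
  have h := RingQuot.mkAlgHom_rel F (s := uRel p F L) ⟨x, rfl, rfl⟩
  rw [map_pow] at h
  exact h.symm

theorem uemb_mul_sub_mul (x y : L) :
    uemb p F L x * uemb p F L y - uemb p F L y * uemb p F L x = uemb p F L ⁅x, y⁆ := by
  simp only [uemb, LinearMap.comp_apply, LieHom.coe_toLinearMap, AlgHom.toLinearMap_apply,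
    LieHom.map_lie, LieRing.of_associative_ring_bracket, map_sub, map_mul]

theorem adjoin_range_uemb : Algebra.adjoin F (Set.range (uemb p F L)) = ⊤ := by
  rw [eq_top_iff]
  rintro u -
  obtain ⟨v, rfl⟩ := RingQuot.mkAlgHom_surjective F (uRel p F L) u
  obtain ⟨w, rfl⟩ : ∃ w, mkAlgHom F L w = v := Quotient.exists_rep v
  induction w using TensorAlgebra.induction with
  | algebraMap r => simp only [AlgHom.commutes]; exact Subalgebra.algebraMap_mem _ r
  | ι x => exact Algebra.subset_adjoin ⟨x, rfl⟩
  | mul a b ha hb => simp only [map_mul]; exact mul_mem ha hb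
  | add a b ha hb => simp only [map_add]; exact add_mem ha hb

theorem lie_mem_derivedSub (x y : L) : ⁅x, y⁆ ∈ derivedSub F L :=
  LieSubmodule.lie_mem_lie (LieSubmodule.mem_top x) (LieSubmodule.mem_top y)

variable (p F L) in
/-- The ideal `u(L)L' = L'u(L)` of `u(L)`. -/
def derivedIdeal : Ideal (uEnv p F L) :=
  Ideal.span (uemb p F L '' derivedSub F L)

theorem uemb_mem_derivedIdeal {y : L} (hy : y ∈ derivedSub F L) :
    uemb p F L y ∈ derivedIdeal p F L :=
  Ideal.subset_span ⟨y, hy, rfl⟩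

instance derivedIdeal_isTwoSided : (derivedIdeal p F L).IsTwoSided := by
  refine ⟨fun {z} w hz => ?_⟩
  have hw : w ∈ Algebra.adjoin F (Set.range (uemb p F L)) := by
    rw [adjoin_range_uemb]; trivial
  induction hw using Algebra.adjoin_induction generalizing z with
  | mem w hw =>
    obtain ⟨x, rfl⟩ := hw
    induction hz using Submodule.span_induction with
    | mem z hz =>
      obtain ⟨y, hy, rfl⟩ := hz
      rw [← sub_add_cancel (uemb p F L y * uemb p F L x) (uemb p F L x * uemb p F L y),
        uemb_mul_sub_mul]
      exact add_mem (uemb_mem_derivedIdeal (lie_mem_derivedSub y x))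
        (Ideal.mul_mem_left _ _ (uemb_mem_derivedIdeal hy))
    | zero => simp
    | add a b _ _ ha hb => rw [add_mul]; exact add_mem ha hb
    | smul c a _ ha => rw [smul_mul_assoc]; exact Submodule.smul_mem _ c ha
  | algebraMap r => rw [← Algebra.commutes]; exact Ideal.mul_mem_left _ _ hz
  | add a b _ _ ha hb => rw [mul_add]; exact add_mem (ha hz) (hb hz)
  | mul a b _ _ ha hb => rw [← mul_assoc]; exact hb (ha hz)

theorem commute_mk_derivedIdeal (a b : uEnv p F L) :
    Commute (Ideal.Quotient.mk (derivedIdeal p F L) a)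
      (Ideal.Quotient.mk (derivedIdeal p F L) b) := by
  have ha : a ∈ Algebra.adjoin F (Set.range (uemb p F L)) := by
    rw [adjoin_range_uemb]; trivial
  have hb : b ∈ Algebra.adjoin F (Set.range (uemb p F L)) := by
    rw [adjoin_range_uemb]; trivial
  induction ha, hb using Algebra.adjoin_induction₂ with
  | mem_mem x y hx hy =>
    obtain ⟨x, rfl⟩ := hx
    obtain ⟨y, rfl⟩ := hy
    refine commute_iff_eq _ _ |>.2 (Ideal.Quotient.eq.2 ?_)
    rw [uemb_mul_sub_mul]
    exact uemb_mem_derivedIdeal (lie_mem_derivedSub x y)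
  | algebraMap_both r s => exact (Algebra.commute_algebraMap_left r _).map _
  | algebraMap_left r x _ => exact (Algebra.commute_algebraMap_left r _).map _
  | algebraMap_right r x _ => exact (Algebra.commute_algebraMap_right r _).map _
  | mul_left x y z _ _ _ h₁ h₂ => rw [map_mul]; exact h₁.mul_left h₂
  | mul_right x y z _ _ _ h₁ h₂ => rw [map_mul]; exact h₁.mul_right h₂
  | add_left x y z _ _ _ h₁ h₂ => rw [map_add]; exact h₁.add_left h₂
  | add_right x y z _ _ _ h₁ h₂ => rw [map_add]; exact h₁.add_right h₂

theorem mul_sub_mul_mem_derivedIdeal (a b : uEnv p F L) :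
    a * b - b * a ∈ derivedIdeal p F L := by
  rw [← Ideal.Quotient.eq, map_mul, map_mul]
  exact commute_mk_derivedIdeal a b

variable [Fact p.Prime]

theorem uemb_mem_derivedIdeal_of_mem_derivedP {x : L} (hx : x ∈ derivedP p F L) :
    uemb p F L x ∈ derivedIdeal p F L := by
  let K : LieSubalgebra F L :=
    { ((derivedIdeal p F L).restrictScalars F).comap (uemb p F L) with
      lie_mem' := fun {x y} _ _ => uemb_mem_derivedIdeal (lie_mem_derivedSub x y) }
  have hK : restrictedClosure p F (derivedSub F L : Set L) ≤ K := by
    refine sInf_le ⟨fun y hy => uemb_mem_derivedIdeal hy, fun y hy => ?_⟩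
    change uemb p F L (pmap p F L y) ∈ derivedIdeal p F L
    rw [uemb_pmap]
    exact Ideal.pow_mem_of_mem _ hy p (Fact.out : p.Prime).pos
  exact hK hx

theorem mem_omegaIdeal {a : uEnv p F L} : a ∈ omegaIdeal p F L ↔ aug p F L a = 0 := Iff.rfl

theorem uemb_mem_omegaIdeal (x : L) : uemb p F L x ∈ omegaIdeal p F L := by
  simp [mem_omegaIdeal, aug, uemb]

theorem mul_mem_omegaIdeal_left (a : uEnv p F L) {b : uEnv p F L} (hb : b ∈ omegaIdeal p F L) :
    a * b ∈ omegaIdeal p F L := by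
  rw [mem_omegaIdeal] at *; simp [hb]

theorem mul_mem_omegaIdeal_right {a : uEnv p F L} (b : uEnv p F L)
    (ha : a ∈ omegaIdeal p F L) : a * b ∈ omegaIdeal p F L := by
  rw [mem_omegaIdeal] at *; simp [ha]

theorem mul_uemb_mem_jIdeal {a : uEnv p F L} (ha : a ∈ omegaIdeal p F L) {y : L}
    (hy : y ∈ derivedSub F L) : a * uemb p F L y ∈ jIdeal p F L :=
  Submodule.mem_sup_left (Submodule.mul_mem_mul ha (Submodule.mem_map_of_mem hy))

theorem uemb_mul_mem_jIdeal {a : uEnv p F L} (ha : a ∈ omegaIdeal p F L) {y : L}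
    (hy : y ∈ derivedSub F L) : uemb p F L y * a ∈ jIdeal p F L :=
  Submodule.mem_sup_right (Submodule.mul_mem_mul (Submodule.mem_map_of_mem hy) ha)

theorem jIdeal_le {N : Submodule F (uEnv p F L)}
    (hl : ∀ a ∈ omegaIdeal p F L, ∀ y ∈ derivedSub F L, a * uemb p F L y ∈ N)
    (hr : ∀ a ∈ omegaIdeal p F L, ∀ y ∈ derivedSub F L, uemb p F L y * a ∈ N) :
    jIdeal p F L ≤ N := by
  refine sup_le (Submodule.mul_le.2 ?_) (Submodule.mul_le.2 ?_)
  · rintro a ha _ ⟨y, hy, rfl⟩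
    exact hl a ha y hy
  · rintro _ ⟨y, hy, rfl⟩ a ha
    exact hr a ha y hy

theorem mul_derivedIdeal_mem_jIdeal {a z : uEnv p F L} (ha : a ∈ omegaIdeal p F L)
    (hz : z ∈ derivedIdeal p F L) : a * z ∈ jIdeal p F L := by
  induction hz using Submodule.span_induction generalizing a with
  | mem z hz =>
    obtain ⟨y, hy, rfl⟩ := hz
    exact mul_uemb_mem_jIdeal ha hy
  | zero => simp
  | add b c _ _ hb hc => rw [mul_add]; exact add_mem (hb ha) (hc ha)
  | smul c b _ hb =>
    rw [smul_eq_mul, ← mul_assoc]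
    exact hb (mul_mem_omegaIdeal_right c ha)

theorem mul_mem_jIdeal_left (u : uEnv p F L) {v : uEnv p F L} (hv : v ∈ jIdeal p F L) :
    u * v ∈ jIdeal p F L := by
  suffices h : jIdeal p F L ≤ (jIdeal p F L).comap (LinearMap.mulLeft F u) from h hv
  refine jIdeal_le (fun a ha y hy => ?_) (fun a ha y hy => ?_)
  · change u * (a * uemb p F L y) ∈ jIdeal p F L
    rw [← mul_assoc]
    exact mul_uemb_mem_jIdeal (mul_mem_omegaIdeal_left u ha) hy
  · change u * (uemb p F L y * a) ∈ jIdeal p F L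
    have hu : u - algebraMap F _ (aug p F L u) ∈ omegaIdeal p F L := by
      simp [mem_omegaIdeal]
    rw [← sub_add_cancel u (algebraMap F _ (aug p F L u)), add_mul, ← Algebra.smul_def]
    exact add_mem (mul_derivedIdeal_mem_jIdeal hu
      (Ideal.IsTwoSided.mul_mem_of_left a (uemb_mem_derivedIdeal hy)))
      (Submodule.smul_mem _ _ (uemb_mul_mem_jIdeal ha hy))

theorem mul_mem_jIdeal_right {u : uEnv p F L} (v : uEnv p F L) (hu : u ∈ jIdeal p F L) :
    u * v ∈ jIdeal p F L := by
  suffices h : jIdeal p F L ≤ (jIdeal p F L).comap (LinearMap.mulRight F v) from h hu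
  refine jIdeal_le (fun a ha y hy => ?_) (fun a ha y hy => ?_)
  · change a * uemb p F L y * v ∈ jIdeal p F L
    rw [mul_assoc]
    exact mul_derivedIdeal_mem_jIdeal ha
      (Ideal.IsTwoSided.mul_mem_of_left v (uemb_mem_derivedIdeal hy))
  · change uemb p F L y * a * v ∈ jIdeal p F L
    rw [mul_assoc]
    exact uemb_mul_mem_jIdeal (mul_mem_omegaIdeal_right v ha) hy

theorem derivedIdeal_mul_mem_jIdeal {a z : uEnv p F L} (hz : z ∈ derivedIdeal p F L)
    (ha : a ∈ omegaIdeal p F L) : z * a ∈ jIdeal p F L := by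
  induction hz using Submodule.span_induction with
  | mem z hz =>
    obtain ⟨y, hy, rfl⟩ := hz
    exact uemb_mul_mem_jIdeal ha hy
  | zero => simp
  | add b c _ _ hb hc => rw [add_mul]; exact add_mem hb hc
  | smul c b _ hb =>
    rw [smul_mul_assoc]
    exact mul_mem_jIdeal_left c hb

variable (p F L) in
/-- `J_L` as a (left) ideal of `u(L)`. -/
noncomputable def jLeftIdeal : Ideal (uEnv p F L) where
  __ := (jIdeal p F L).toAddSubmonoid
  smul_mem' u _ hv := mul_mem_jIdeal_left u hv

theorem mem_jLeftIdeal {u : uEnv p F L} : u ∈ jLeftIdeal p F L ↔ u ∈ jIdeal p F L := Iff.rfl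

instance jLeftIdeal_isTwoSided : (jLeftIdeal p F L).IsTwoSided :=
  ⟨fun b hu => mul_mem_jIdeal_right b hu⟩

/-- `p`-th powers are additive modulo `J_L` on elements commuting modulo `J_L`. -/
theorem add_pow_sub_mem_jIdeal [CharP F p] {u v : uEnv p F L}
    (h : u * v - v * u ∈ jIdeal p F L) :
    (u + v) ^ p - (u ^ p + v ^ p) ∈ jIdeal p F L := by
  have hc : Commute (Ideal.Quotient.mk (jLeftIdeal p F L) u)
      (Ideal.Quotient.mk (jLeftIdeal p F L) v) := by
    rw [commute_iff_eq, ← map_mul, ← map_mul, Ideal.Quotient.eq]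
    exact h
  obtain ⟨r, hr⟩ := hc.exists_add_pow_prime_eq (Fact.out : p.Prime)
  have hp : (p : uEnv p F L) = 0 := by
    rw [← map_natCast (algebraMap F (uEnv p F L)), CharP.cast_eq_zero, map_zero]
  rw [← mem_jLeftIdeal, ← Ideal.Quotient.eq]
  simp only [map_pow, map_add]
  rw [hr, ← map_natCast (Ideal.Quotient.mk (jLeftIdeal p F L)), hp]
  simp

end Ideals

section Words

variable {p : ℕ} {F : Type*} [Field F]
variable {L : Type*} [LieRing L] [LieAlgebra F L] [RestrictedLieAlgebra p F L]
variable {Q : Type*}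

theorem word_sub_word_mem_derivedIdeal {c d : Q → uEnv p F L}
    (h : ∀ q, c q - d q ∈ derivedIdeal p F L) (l : List Q) :
    (l.map c).prod - (l.map d).prod ∈ derivedIdeal p F L := by
  rw [← Ideal.Quotient.eq, map_list_prod, map_list_prod, List.map_map, List.map_map]
  congr 2
  exact funext fun q => Ideal.Quotient.eq.2 (h q)

theorem mk_word_pow (c : Q → uEnv p F L) (k : ℕ) (l : List Q) :
    Ideal.Quotient.mk (derivedIdeal p F L) ((l.map c).prod ^ k)
      = Ideal.Quotient.mk (derivedIdeal p F L) (l.map fun q => c q ^ k).prod := by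
  induction l with
  | nil => simp
  | cons q t ih =>
    simp only [List.map_cons, List.prod_cons, map_mul, map_pow] at ih ⊢
    rw [(commute_mk_derivedIdeal _ _).mul_pow, ih]

variable [Fact p.Prime]

theorem word_mem_omegaIdeal {c : Q → uEnv p F L} (hc : ∀ q, c q ∈ omegaIdeal p F L)
    {l : List Q} (hl : l ≠ []) : (l.map c).prod ∈ omegaIdeal p F L := by
  obtain ⟨q, t, rfl⟩ := List.exists_cons_of_ne_nil hl
  rw [List.map_cons, List.prod_cons]
  exact mul_mem_omegaIdeal_right _ (hc q)

theorem word_commutator_mem_jIdeal {c : Q → uEnv p F L} (hc : ∀ q, c q ∈ omegaIdeal p F L)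
    {l : List Q} (hl : 2 ≤ l.length) (v : uEnv p F L) :
    (l.map c).prod * v - v * (l.map c).prod ∈ jIdeal p F L := by
  obtain - | ⟨q, t⟩ := l
  · simp at hl
  have ht : (t.map c).prod ∈ omegaIdeal p F L :=
    word_mem_omegaIdeal hc (by rintro rfl; simp at hl)
  rw [List.map_cons, List.prod_cons]
  have := add_mem
    (mul_derivedIdeal_mem_jIdeal (hc q) (mul_sub_mul_mem_derivedIdeal (t.map c).prod v))
    (derivedIdeal_mul_mem_jIdeal (mul_sub_mul_mem_derivedIdeal (c q) v) ht)
  convert this using 1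
  noncomm_ring

/-- Words of length at least two which agree letterwise modulo `u(L)L'` agree modulo `J_L`. -/
theorem word_sub_word_mem_jIdeal {c d : Q → uEnv p F L} (hc : ∀ q, c q ∈ omegaIdeal p F L)
    (hd : ∀ q, d q ∈ omegaIdeal p F L) (h : ∀ q, c q - d q ∈ derivedIdeal p F L)
    {l : List Q} (hl : 2 ≤ l.length) :
    (l.map c).prod - (l.map d).prod ∈ jIdeal p F L := by
  obtain - | ⟨q, t⟩ := l
  · simp at hl
  have ht : (t.map d).prod ∈ omegaIdeal p F L :=
    word_mem_omegaIdeal hd (by rintro rfl; simp at hl)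
  simp only [List.map_cons, List.prod_cons]
  have := add_mem
    (mul_derivedIdeal_mem_jIdeal (hc q) (word_sub_word_mem_derivedIdeal h t))
    (derivedIdeal_mul_mem_jIdeal (h q) ht)
  convert this using 1
  noncomm_ring

theorem word_pow_sub_mem_jIdeal {c : Q → uEnv p F L} (hc : ∀ q, c q ∈ omegaIdeal p F L)
    (k : ℕ) (l : List Q) :
    (l.map c).prod ^ (k + 1) - (l.map fun q => c q ^ (k + 1)).prod ∈ jIdeal p F L := by
  obtain - | ⟨q, t⟩ := l
  · simp
  simp only [List.map_cons, List.prod_cons]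
  rw [pow_succ', pow_succ' (c q), mul_assoc, mul_assoc, ← mul_sub]
  refine mul_derivedIdeal_mem_jIdeal (hc q) (Ideal.Quotient.eq.1 ?_)
  rw [map_mul, map_mul, ← mk_word_pow, map_pow, map_pow, map_pow, map_mul,
    (commute_mk_derivedIdeal _ _).mul_pow, pow_succ', ← mul_assoc, ← mul_assoc,
    ((commute_mk_derivedIdeal _ _).pow_right k).eq]

end Words

section Monomials

variable {n : ℕ} {ex : Fin n → ℕ}

/-- The word in the letters `(i, j)`, in lexicographic order, in which `(i, j)` occurs
`a i j` times. -/
def exponentWord (a : (i : Fin n) → Fin (ex i) → ℕ) : List (Σ i : Fin n, Fin (ex i)) :=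
  (List.finRange n).flatMap fun i =>
    (List.finRange (ex i)).flatMap fun j => List.replicate (a i j) ⟨i, j⟩

theorem prod_map_flatMap {α β M : Type*} [Monoid M] (f : β → M) (g : α → List β) (l : List α) :
    ((l.flatMap g).map f).prod = (l.map fun x => ((g x).map f).prod).prod := by
  induction l with
  | nil => simp
  | cons x t ih => simp [ih]

theorem exponentWord_prod {M : Type*} [Monoid M] (a : (i : Fin n) → Fin (ex i) → ℕ)
    (c : (i : Fin n) → Fin (ex i) → M) :
    ((exponentWord a).map fun q => c q.1 q.2).prod
      = ((List.finRange n).map fun i =>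
          ((List.finRange (ex i)).map fun j => c i j ^ a i j).prod).prod := by
  simp [exponentWord, prod_map_flatMap]

theorem exponentWord_length (a : (i : Fin n) → Fin (ex i) → ℕ) :
    (exponentWord a).length = ∑ i, ∑ j, a i j := by
  simp [exponentWord, List.length_flatMap, ← List.ofFn_eq_map, List.sum_ofFn]

/-- Shift a sequence one place up, with value `0` at the start. -/
def shiftUp {k : ℕ} (a : Fin k → ℕ) (j : Fin k) : ℕ :=
  if (j : ℕ) = 0 then 0 else a ⟨j - 1, by omega⟩

/-- Shift a sequence one place down, with value `0` at the end. -/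
def shiftDown {M : Type*} [Zero M] {k : ℕ} (x : Fin k → M) (j : Fin k) : M :=
  if h : (j : ℕ) + 1 < k then x ⟨j + 1, h⟩ else 0

theorem prod_shiftDown_pow {M : Type*} [MonoidWithZero M] {k : ℕ} (x : Fin k → M)
    (a : Fin k → ℕ) (ha : ∀ j : Fin k, (j : ℕ) + 1 = k → a j = 0) :
    ((List.finRange k).map fun j => shiftDown x j ^ a j).prod
      = ((List.finRange k).map fun j => x j ^ shiftUp a j).prod := by
  obtain - | k := k
  · simp
  conv_lhs => rw [List.finRange_succ_last]
  conv_rhs => rw [List.finRange_succ]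
  have hl : a (Fin.last k) = 0 := ha _ (by simp)
  simp only [List.map_append, List.map_map, List.prod_append, List.map_cons, List.prod_cons,
    List.map_nil, List.prod_nil, hl]
  simp [shiftUp, shiftDown, Function.comp_def, Fin.succ, Fin.castSucc, Fin.castAdd, Fin.castLE]

theorem sum_shiftUp {k : ℕ} (a : Fin k → ℕ) (ha : ∀ j : Fin k, (j : ℕ) + 1 = k → a j = 0) :
    ∑ j, shiftUp a j = ∑ j, a j := by
  obtain - | k := k
  · simp
  rw [Fin.sum_univ_succ, Fin.sum_univ_castSucc, ha (Fin.last k) (by simp)]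
  simp [shiftUp, Fin.castSucc, Fin.castAdd, Fin.castLE]

end Monomials

section ESpace

variable {p : ℕ} {F : Type*} [Field F] [Fact p.Prime]
variable {L : Type*} [LieRing L] [LieAlgebra F L] [RestrictedLieAlgebra p F L]
variable {n : ℕ} {e : Fin n → L} {ex : Fin n → ℕ} {X : (i : Fin n) → Fin (ex i) → L}

theorem uemb_sub_uemb_mem_derivedIdeal {x y : L} (h : x - y ∈ derivedP p F L) :
    uemb p F L x - uemb p F L y ∈ derivedIdeal p F L := by
  rw [← map_sub]
  exact uemb_mem_derivedIdeal_of_mem_derivedP h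

theorem uemb_pow_sub_shiftDown_mem_derivedIdeal (hpres : GoodPresentation p F L n e ex X)
    (i : Fin n) (j : Fin (ex i)) :
    uemb p F L (X i j) ^ p - shiftDown (fun j => uemb p F L (X i j)) j
      ∈ derivedIdeal p F L := by
  obtain ⟨-, -, hex, hX⟩ := hpres
  have hpow : uemb p F L (X i j) ^ p - uemb p F L ((pmap p F L)^[(j : ℕ) + 1] (e i))
      ∈ derivedIdeal p F L := by
    rw [Function.iterate_succ_apply', uemb_pmap, ← Ideal.Quotient.eq, map_pow, map_pow,
      Ideal.Quotient.eq.2 (uemb_sub_uemb_mem_derivedIdeal (hX i j))]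
  rw [← sub_add_sub_cancel _ (uemb p F L ((pmap p F L)^[(j : ℕ) + 1] (e i)))]
  refine add_mem hpow ?_
  unfold shiftDown
  split_ifs with h
  · rw [← neg_sub]
    exact neg_mem (uemb_sub_uemb_mem_derivedIdeal (hX i ⟨j + 1, h⟩))
  · have hj : (j : ℕ) + 1 = ex i := by omega
    rw [sub_zero, hj]
    exact uemb_mem_derivedIdeal_of_mem_derivedP (hex i)

theorem jIdeal_le_eSpace : jIdeal p F L ≤ eSpace p F L n ex X := le_sup_left

theorem shiftDown_prod_mem_eSpace {a : (i : Fin n) → Fin (ex i) → ℕ} (ha : ∀ i j, a i j < p)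
    (hdeg : 2 ≤ ∑ i, ∑ j, a i j) :
    ((List.finRange n).map fun i => ((List.finRange (ex i)).map fun j =>
      shiftDown (fun j => uemb p F L (X i j)) j ^ a i j).prod).prod ∈ eSpace p F L n ex X := by
  by_cases h : ∀ i, ∀ j : Fin (ex i), (j : ℕ) + 1 = ex i → a i j = 0
  · refine Submodule.mem_sup_right (Submodule.subset_span
      ⟨fun i => shiftUp (a i), fun i j => ?_, ?_, ?_⟩)
    · simp only [shiftUp]
      split_ifs
      · exact (Fact.out : p.Prime).pos
      · exact ha _ _
    · rwa [Finset.sum_congr rfl fun i _ => sum_shiftUp (a i) (h i)]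
    · congr 2
      exact funext fun i => prod_shiftDown_pow _ _ (h i)
  · push Not at h
    obtain ⟨i, j, hj, hne⟩ := h
    rw [List.prod_eq_zero]
    · exact zero_mem _
    · refine List.mem_map.2 ⟨i, List.mem_finRange i, List.prod_eq_zero ?_⟩
      refine List.mem_map.2 ⟨j, List.mem_finRange j, ?_⟩
      simp [shiftDown, hj, hne]

theorem monomial_pow_mem_eSpace (hpres : GoodPresentation p F L n e ex X)
    {a : (i : Fin n) → Fin (ex i) → ℕ} (ha : ∀ i j, a i j < p)
    (hdeg : 2 ≤ ∑ i, ∑ j, a i j) :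
    ((List.finRange n).map fun i => ((List.finRange (ex i)).map fun j =>
      uemb p F L (X i j) ^ a i j).prod).prod ^ p ∈ eSpace p F L n ex X := by
  have hp := (Fact.out : p.Prime).pos
  obtain ⟨k, hk⟩ : ∃ k, p = k + 1 := ⟨p - 1, by omega⟩
  have hω : ∀ q : Σ i : Fin n, Fin (ex i), uemb p F L (X q.1 q.2) ∈ omegaIdeal p F L :=
    fun q => uemb_mem_omegaIdeal _
  have hpow : ∀ q : Σ i : Fin n, Fin (ex i),
      uemb p F L (X q.1 q.2) ^ p ∈ omegaIdeal p F L := fun q => by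
    rw [← uemb_pmap]; exact uemb_mem_omegaIdeal _
  have hdown : ∀ q : Σ i : Fin n, Fin (ex i),
      shiftDown (fun j => uemb p F L (X q.1 j)) q.2 ∈ omegaIdeal p F L := fun q => by
    unfold shiftDown
    split_ifs
    · exact uemb_mem_omegaIdeal _
    · exact zero_mem _
  rw [← exponentWord_prod a fun i j => uemb p F L (X i j)]
  have h₁ := word_pow_sub_mem_jIdeal hω k (exponentWord a)
  rw [← hk] at h₁
  have h₂ := word_sub_word_mem_jIdeal hpow hdown
    (fun q => uemb_pow_sub_shiftDown_mem_derivedIdeal hpres q.1 q.2)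
    (hdeg.trans_eq (exponentWord_length a).symm)
  have h₃ := shiftDown_prod_mem_eSpace (F := F) (L := L) (X := X) ha hdeg
  rw [← exponentWord_prod a fun i j => shiftDown (fun j => uemb p F L (X i j)) j] at h₃
  have h := add_mem (jIdeal_le_eSpace (add_mem h₁ h₂)) h₃
  rwa [sub_add_sub_cancel, sub_add_cancel] at h

theorem eSpace_le {N : Submodule F (uEnv p F L)} (hJ : jIdeal p F L ≤ N)
    (hN : ∀ l : List (Σ i : Fin n, Fin (ex i)), 2 ≤ l.length →
      (l.map fun q => uemb p F L (X q.1 q.2)).prod ∈ N) : eSpace p F L n ex X ≤ N := by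
  refine sup_le hJ (Submodule.span_le.2 ?_)
  rintro _ ⟨a, -, hdeg, rfl⟩
  rw [← exponentWord_prod a fun i j => uemb p F L (X i j)]
  exact hN _ (hdeg.trans_eq (exponentWord_length a).symm)

theorem eSpace_commutator_mem_jIdeal {u : uEnv p F L} (hu : u ∈ eSpace p F L n ex X)
    (v : uEnv p F L) : u * v - v * u ∈ jIdeal p F L := by
  suffices h : eSpace p F L n ex X ≤
      (jIdeal p F L).comap (LinearMap.mulRight F v - LinearMap.mulLeft F v) from h hu
  exact eSpace_le
    (fun w hw => sub_mem (mul_mem_jIdeal_right v hw) (mul_mem_jIdeal_left v hw))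
    (fun l hl => word_commutator_mem_jIdeal (fun _ => uemb_mem_omegaIdeal _) hl v)

theorem add_pow_mem_eSpace [CharP F p] {u v : uEnv p F L} (hu : u ∈ eSpace p F L n ex X)
    (hup : u ^ p ∈ eSpace p F L n ex X) (hvp : v ^ p ∈ eSpace p F L n ex X) : (u + v) ^ p ∈ eSpace p F L n ex X := by
  have h := add_mem (jIdeal_le_eSpace (n := n) (ex := ex) (X := X) (add_pow_sub_mem_jIdeal
    (eSpace_commutator_mem_jIdeal hu v))) (add_mem hup hvp)
  rwa [sub_add_cancel] at h

theorem pow_mem_eSpace [CharP F p] (hpres : GoodPresentation p F L n e ex X)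
    {u : uEnv p F L} (hu : u ∈ eSpace p F L n ex X) : u ^ p ∈ eSpace p F L n ex X := by
  have hp := (Fact.out : p.Prime).pos
  obtain ⟨j, hj, w, hw, rfl⟩ := Submodule.mem_sup.1 hu
  refine add_pow_mem_eSpace (jIdeal_le_eSpace hj)
    (jIdeal_le_eSpace (Ideal.pow_mem_of_mem (jLeftIdeal p F L) hj p hp)) ?_
  clear hu
  induction hw using Submodule.span_induction with
  | mem w hw =>
    obtain ⟨a, ha, hdeg, rfl⟩ := hw
    exact monomial_pow_mem_eSpace hpres ha hdeg
  | zero => rw [zero_pow hp.ne']; exact zero_mem _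
  | add v w hv _ ihv ihw =>
    exact add_pow_mem_eSpace (Submodule.mem_sup_right hv) ihv ihw
  | smul c w _ ih => rw [smul_pow]; exact Submodule.smul_mem _ _ ih

end ESpace

end RestrictedLieAlgebra

open RestrictedLieAlgebra in
/-- With `X` and `E` as in the running setup, `E/J_L` is a central restricted Lie ideal
of `ω(L)/J_L`: `[E, ω(L)] ⊆ J_L` and `E` is closed under `p`-th powers. -/
theorem eSpace_central_restricted_ideal
    (p : ℕ) (F L : Type*) [Field F] [Fact p.Prime] [CharP F p] [PerfectField F]
    [LieRing L] [LieAlgebra F L] [RestrictedLieAlgebra p F L]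
    [FiniteDimensional F L] (hL : IsPNilpotent p F L)
    (n : ℕ) (e : Fin n → L) (ex : Fin n → ℕ) (X : (i : Fin n) → Fin (ex i) → L)
    (hpres : GoodPresentation p F L n e ex X) :
    (∀ u ∈ eSpace p F L n ex X, ∀ v ∈ omegaIdeal p F L,
        u * v - v * u ∈ jIdeal p F L) ∧
    (∀ u ∈ eSpace p F L n ex X, u ^ p ∈ eSpace p F L n ex X) := by
  exact ⟨fun _ hu v _ => eSpace_commutator_mem_jIdeal hu v,
    fun _ hu => pow_mem_eSpace hpres hu⟩
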